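/- Let n ≥ 3 be an integer and p ∈ (n, n+1]. Then for every z > 1 and every k ∈ {0,1,…,n−1}, the k-th derivative of the map x ↦ ψ(z,x), evaluated at x = z, is strictly negative. -/

import Mathlib

/-- `f(t) = t²/2 - tᵖ/p`. -/
noncomputable def f (p t : ℝ) : ℝ := t ^ 2 / 2 - t ^ p / p

/-- First derivative: `f'(t) = t - t^(p-1)`. -/
noncomputable def f' (p t : ℝ) : ℝ := t - t ^ (p - 1)

/-- Second derivative: `f''(t) = 1 - (p-1) t^(p-2)`. -/
noncomputable def f'' (p t : ℝ) : ℝ := 1 - (p - 1) * t ^ (p - 2)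

/-- `ψ(z,x) = -f'(x)² - 3 f'(z) (f'(x) + (z-x) f''(x))`. -/
noncomputable def ψ (p z x : ℝ) : ℝ :=
  -(f' p x) ^ 2 - 3 * f' p z * (f' p x + (z - x) * f'' p x)

theorem mul_descPochhammer_eval_sub_one (q : ℝ) (k : ℕ) :
    q * (descPochhammer ℝ k).eval (q - 1) = (q - k) * (descPochhammer ℝ k).eval q := by
  induction k with
  | zero => simp
  | succ k ih =>
    rw [descPochhammer_succ_eval, descPochhammer_succ_eval, ← mul_assoc, ih]
    push_cast
    ring

theorem descPochhammer_eval_pos_of_lt (q : ℝ) (k : ℕ) (hk : (k : ℝ) < q + 1) :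
    0 < (descPochhammer ℝ k).eval q :=
  descPochhammer_pos (by linarith)

theorem two_pow_mul_descPochhammer_eval_le (q : ℝ) (k : ℕ) (hk : (k : ℝ) < q + 1) :
    2 ^ k * (descPochhammer ℝ k).eval q ≤ (descPochhammer ℝ k).eval (2 * q) := by
  induction k with
  | zero => simp
  | succ k ih =>
    push_cast at hk
    have hpos := descPochhammer_eval_pos_of_lt q k (by linarith)
    rw [descPochhammer_succ_eval, descPochhammer_succ_eval]
    calc 2 ^ (k + 1) * ((descPochhammer ℝ k).eval q * (q - k))
        = (2 ^ k * (descPochhammer ℝ k).eval q) * (2 * (q - k)) := by ring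
      _ ≤ (descPochhammer ℝ k).eval (2 * q) * (2 * q - k) := by
        have hk0 : (0 : ℝ) ≤ k := k.cast_nonneg
        exact mul_le_mul (ih (by linarith)) (by linarith) (by linarith)
          ((by positivity : (0 : ℝ) ≤ 2 ^ k * _).trans (ih (by linarith)))

theorem three_mul_add_two_le_two_pow (j : ℕ) : 3 * (j + 2) ≤ 2 ^ (j + 3) := by
  induction j with
  | zero => norm_num
  | succ j ih => rw [show j + 1 + 3 = (j + 3) + 1 by ring, pow_succ]; omega

theorem descPochhammer_two_eval_eq_zero (j : ℕ) :
    (descPochhammer ℝ (j + 3)).eval 2 = 0 := by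
  exact_mod_cast descPochhammer_eval_coe_nat_of_lt (R := ℝ) (k := 2) (n := j + 3) (by omega)

theorem two_mul_descPochhammer_eval_add_one_lt (q : ℝ) (j : ℕ) (hk : (j : ℝ) + 3 < q + 1) :
    2 * (descPochhammer ℝ (j + 3)).eval (q + 1) < (descPochhammer ℝ (j + 3)).eval (2 * q) := by
  induction j with
  | zero =>
    norm_num at hk
    simp only [zero_add, descPochhammer_succ_eval, descPochhammer_zero, Polynomial.eval_one]
    push_cast
    have : 0 < q * (q - 1) := mul_pos (by linarith) (by linarith)
    nlinarith
  | succ j ih =>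
    push_cast at hk
    have hj : (0 : ℝ) ≤ j := j.cast_nonneg
    have hpos := descPochhammer_eval_pos_of_lt (q + 1) (j + 3) (by push_cast; linarith)
    have ih := ih (by linarith)
    rw [show j + 1 + 3 = (j + 3) + 1 by ring, descPochhammer_succ_eval (j + 3),
      descPochhammer_succ_eval (j + 3),
      ← mul_assoc]
    push_cast
    exact mul_lt_mul ih (by linarith) (by linarith) (by linarith)

/-- The normalized `k`-th derivative of `ψ p z` at `z`, with `q = p - 1` and `w = z ^ (p - 2)`. -/
noncomputable def psiBracket (q w : ℝ) (k : ℕ) : ℝ :=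
  -(descPochhammer ℝ k).eval 2 + 2 * (descPochhammer ℝ k).eval (q + 1) * w
    - (descPochhammer ℝ k).eval (2 * q) * w ^ 2
    - 3 * (1 - w) * ((descPochhammer ℝ k).eval 0 + (k - 1) * (descPochhammer ℝ k).eval q * w)

theorem psiBracket_neg (q w : ℝ) (hq : 2 < q) (hw : 1 < w) (k : ℕ) (hk : (k : ℝ) < q) :
    psiBracket q w k < 0 := by
  unfold psiBracket
  match k, hk with
  | 0, _ =>
    simp only [descPochhammer_zero, Polynomial.eval_one]
    push_cast
    nlinarith [mul_pos (sub_pos.2 hw) (sub_pos.2 hw)]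
  | 1, _ =>
    simp only [descPochhammer_one, Polynomial.eval_X]
    push_cast
    have h : 0 < (w - 1) * (q * w - 1) := mul_pos (by linarith) (by nlinarith)
    nlinarith
  | 2, _ =>
    simp only [descPochhammer_succ_eval, descPochhammer_zero, Polynomial.eval_one]
    push_cast
    have h1 : 0 < (q - 1) ^ 2 := by nlinarith
    have h2 : 0 < (w - 1) * (q * (q - 1)) :=
      mul_pos (by linarith) (mul_pos (by linarith) (by linarith))
    have h3 : 0 < (w - 1) ^ 2 * (q * (q + 1)) :=
      mul_pos (by nlinarith) (mul_pos (by linarith) (by linarith))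
    linear_combination 2 * h1 + 3 * h2 + h3
  | j + 3, hk =>
    push_cast at hk
    have hA := two_mul_descPochhammer_eval_add_one_lt q j (by linarith)
    have hB := two_pow_mul_descPochhammer_eval_le q (j + 3) (by push_cast; linarith)
    have hpos := descPochhammer_eval_pos_of_lt q (j + 3) (by push_cast; linarith)
    have hC : (3 : ℝ) * (j + 2) ≤ 2 ^ (j + 3) := by
      exact_mod_cast three_mul_add_two_le_two_pow j
    rw [descPochhammer_two_eval_eq_zero, descPochhammer_ne_zero_eval_zero _ (by omega)]
    push_cast
    generalize (descPochhammer ℝ (j + 3)).eval (q + 1) = A at *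
    generalize (descPochhammer ℝ (j + 3)).eval (2 * q) = B at *
    generalize (descPochhammer ℝ (j + 3)).eval q = D at *
    have hD : 3 * (j + 2) * D ≤ B := (mul_le_mul_of_nonneg_right hC hpos.le).trans hB
    have h1 : 0 < w * (B - 2 * A) := mul_pos (by linarith) (by linarith)
    have h2 : 0 ≤ w * (w - 1) * (B - 3 * (j + 2) * D) :=
      mul_nonneg (mul_nonneg (by linarith) (by linarith)) (by linarith)
    linear_combination h1 + h2

theorem iteratedDeriv_sum_const_mul_rpow {ι : Type*} (s : Finset ι) (c a : ι → ℝ) {z : ℝ}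
    (hz : z ≠ 0) (k : ℕ) :
    iteratedDeriv k (fun x : ℝ => ∑ i ∈ s, c i * x ^ a i) z =
      ∑ i ∈ s, c i * ((descPochhammer ℝ k).eval (a i) * z ^ (a i - k)) := by
  rw [iteratedDeriv_fun_sum fun i _ =>
    contDiffAt_const.mul (Real.contDiffAt_rpow_const_of_ne hz)]
  refine Finset.sum_congr rfl fun i _ => ?_
  rw [iteratedDeriv_const_mul_field, iteratedDeriv_eq_iterate, Real.iter_deriv_rpow_const]

theorem psi_eq_sum_rpow (q z x : ℝ) (hx : 0 < x) :
    ψ (q + 1) z x = ∑ i : Fin 6,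
      (![-1, 2, -1, -3 * (z - z ^ q) * z, -3 * (z - z ^ q) * (q - 1),
        3 * (z - z ^ q) * z * q] : Fin 6 → ℝ) i *
        x ^ (![2, q + 1, 2 * q, 0, q, q - 1] : Fin 6 → ℝ) i := by
  have e1 : x ^ (q + 1) = x ^ (q - 1) * x ^ 2 := by
    rw [← Real.rpow_natCast, ← Real.rpow_add hx]; norm_num; ring_nf
  have e2 : x ^ (2 * q) = (x ^ (q - 1)) ^ 2 * x ^ 2 := by
    rw [← Real.rpow_natCast, ← Real.rpow_natCast, ← Real.rpow_mul hx.le, ← Real.rpow_add hx]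
    norm_num; ring_nf
  have e3 : x ^ q = x ^ (q - 1) * x := by
    rw [← Real.rpow_add_one hx.ne']; ring_nf
  simp only [ψ, f', f'', Fin.sum_univ_six, add_sub_cancel_right]
  simp only [Matrix.cons_val]
  rw [show q + 1 - 2 = q - 1 by ring, e1, e2, e3, Real.rpow_zero, Real.rpow_two]
  ring

theorem iteratedDeriv_psi_self (q z : ℝ) (hz : 0 < z) (k : ℕ) :
    iteratedDeriv k (fun x => ψ (q + 1) z x) z =
      z ^ (2 - k : ℝ) * psiBracket q (z ^ (q - 1)) k := by
  have h : (fun x => ψ (q + 1) z x) =ᶠ[nhds z] _ :=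
    (eventually_gt_nhds hz).mono fun x hx => psi_eq_sum_rpow q z x hx
  rw [h.iteratedDeriv_eq, iteratedDeriv_sum_const_mul_rpow _ _ _ hz.ne']
  have hd := mul_descPochhammer_eval_sub_one q k
  have e1 : z ^ (q + 1 - k) = z ^ (q - 1) * z ^ (2 - k : ℝ) := by
    rw [← Real.rpow_add hz]; ring_nf
  have e2 : z ^ (2 * q - k) = (z ^ (q - 1)) ^ 2 * z ^ (2 - k : ℝ) := by
    rw [← Real.rpow_natCast, ← Real.rpow_mul hz.le, ← Real.rpow_add hz]
    norm_num; ring_nf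
  have e3 : z ^ q = z ^ (q - 1) * z := by
    rw [← Real.rpow_add_one hz.ne']; ring_nf
  have e4 : z ^ (q - k) = z ^ (q - 1) * z ^ (1 - k : ℝ) := by
    rw [← Real.rpow_add hz]; ring_nf
  have e5 : z ^ (q - 1 - k) = z ^ (q - 1) * z ^ (0 - k : ℝ) := by
    rw [← Real.rpow_add hz]; ring_nf
  have e6 : z ^ (1 - k : ℝ) = z ^ (0 - k : ℝ) * z := by
    rw [← Real.rpow_add_one hz.ne']; ring_nf
  have e7 : z ^ (2 - k : ℝ) = z ^ (0 - k : ℝ) * z ^ 2 := by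
    rw [← Real.rpow_natCast, ← Real.rpow_add hz]; norm_num; ring_nf
  simp only [psiBracket, Fin.sum_univ_six, Matrix.cons_val]
  rw [e1, e2, e3, e4, e5, e6, e7]
  linear_combination (3 * z ^ 2 * (1 - z ^ (q - 1)) * z ^ (q - 1) * z ^ (0 - k : ℝ)) * hd

/-- let `n ≥ 3` be an integer and `p ∈ (n, n+1]`. Then for every `z > 1` and
every `k ∈ {0,1,…,n-1}`, the `k`-th derivative of `x ↦ ψ(z,x)` at `x = z` is negative. -/
theorem stmt_3 (n : ℕ) (hn : 3 ≤ n) (p : ℝ) (hp1 : (n : ℝ) < p) (hp2 : p ≤ (n : ℝ) + 1)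
    (z : ℝ) (hz : 1 < z) (k : ℕ) (hk : k < n) :
    iteratedDeriv k (fun x => ψ p z x) z < 0 := by
  have hn' : (3 : ℝ) ≤ n := by exact_mod_cast hn
  have hk' : (k : ℝ) + 1 ≤ n := by exact_mod_cast hk
  have hq := iteratedDeriv_psi_self (p - 1) z (by linarith) k
  rw [sub_add_cancel] at hq
  rw [hq]
  exact mul_neg_of_pos_of_neg (Real.rpow_pos_of_pos (by linarith) _)
    (psiBracket_neg _ _ (by linarith) (Real.one_lt_rpow hz (by linarith)) k (by linarith))
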